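/- (Convergence of Hypotheses.) Fix natural numbers c, K with 1 ≤ c ≤ K. Index the constituents compatible with the evidence by the subsets D of a set of size K−c (D is the set of unexemplified attributive constituents the constituent additionally asserts), and for sample size n give the subset D the posterior weight q_n(D) = (1/((c+|D|)⁽ⁿ⁾)) / Z_n with Z_n = Σ_{D' ⊆ {1,…,K−c}} 1/((c+|D'|)⁽ⁿ⁾), where m⁽ⁿ⁾ = m(m+1)⋯(m+n−1) is the ascending factorial. For any family S of subsets of {1,…,K−c} (representing a hypothesis h equal to the disjunction of the corresponding constituents), Σ_{D ∈ S} q_n(D) → 1 as n → ∞ if ∅ ∈ S, and Σ_{D ∈ S} q_n(D) → 0 as n → ∞ if ∅ ∉ S. -/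

import Mathlib

open Filter Finset

/-- The ascending factorial `m⁽ⁿ⁾ = m (m+1) ⋯ (m+n-1)`, as a real number. -/
noncomputable def ascFac (m n : ℕ) : ℝ :=
  ∏ j ∈ Finset.range n, ((m : ℝ) + j)

/-- The normalizing constant `Z_n = ∑_{D' ⊆ {1,…,K-c}} 1/((c+|D'|)⁽ⁿ⁾)`, the sum of the
unnormalized posterior weights over all subsets `D'` of the `K - c` unexemplified
attributive constituents. -/
noncomputable def Znorm (c K n : ℕ) : ℝ :=
  ∑ D' : Finset (Fin (K - c)), 1 / ascFac (c + D'.card) n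

/-- The posterior weight `q_n(D) = (1/((c+|D|)⁽ⁿ⁾)) / Z_n` of the constituent
corresponding to the subset `D` of unexemplified attributive constituents. -/
noncomputable def postWeight (c K n : ℕ) (D : Finset (Fin (K - c))) : ℝ :=
  (1 / ascFac (c + D.card) n) / Znorm c K n

theorem ascFac_pos {m : ℕ} (hm : 1 ≤ m) (n : ℕ) : 0 < ascFac m n := by
  have hm' : (0 : ℝ) < m := by exact_mod_cast hm
  exact Finset.prod_pos fun j _ => by positivity

theorem ascFac_mono {m m' : ℕ} (h : m ≤ m') (n : ℕ) : ascFac m n ≤ ascFac m' n := by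
  have h' : (m : ℝ) ≤ m' := by exact_mod_cast h
  exact Finset.prod_le_prod (fun j _ => by positivity) fun j _ => by gcongr

theorem mul_ascFac_succ (m n : ℕ) :
    (m : ℝ) * ascFac (m + 1) n = ((m : ℝ) + n) * ascFac m n := by
  have h : ascFac m (n + 1) = ascFac (m + 1) n * m := by
    simp only [ascFac, Finset.prod_range_succ']
    push_cast
    simp only [add_zero, add_assoc, add_comm (1 : ℝ)]
  rw [mul_comm, ← h, ascFac, Finset.prod_range_succ, mul_comm, ascFac]

theorem one_div_ascFac_le_Znorm {c : ℕ} (hc : 1 ≤ c) (K n : ℕ) :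
    1 / ascFac c n ≤ Znorm c K n := by
  have h := Finset.single_le_sum (s := Finset.univ)
    (f := fun D : Finset (Fin (K - c)) => 1 / ascFac (c + D.card) n)
    (fun D _ => (one_div_pos.2 (ascFac_pos (Nat.le_add_right_of_le hc) n)).le)
    (Finset.mem_univ ∅)
  simp only [Finset.card_empty, add_zero] at h
  exact h

theorem Znorm_pos {c : ℕ} (hc : 1 ≤ c) (K n : ℕ) : 0 < Znorm c K n :=
  (one_div_pos.2 (ascFac_pos hc n)).trans_le (one_div_ascFac_le_Znorm hc K n)

theorem sum_postWeight {c : ℕ} (hc : 1 ≤ c) (K n : ℕ) :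
    ∑ D : Finset (Fin (K - c)), postWeight c K n D = 1 := by
  simp only [postWeight]
  rw [← Finset.sum_div]
  exact div_self (Znorm_pos hc K n).ne'

theorem postWeight_nonneg {c : ℕ} (hc : 1 ≤ c) (K n : ℕ) (D : Finset (Fin (K - c))) :
    0 ≤ postWeight c K n D :=
  div_nonneg (one_div_pos.2 (ascFac_pos (Nat.le_add_right_of_le hc) n)).le
    (Znorm_pos hc K n).le

theorem postWeight_le {c : ℕ} (hc : 1 ≤ c) (K n : ℕ) {D : Finset (Fin (K - c))}
    (hD : D.Nonempty) : postWeight c K n D ≤ c / (n + c : ℝ) := by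
  have hc' : (0 : ℝ) < c := by exact_mod_cast hc
  have h₀ := ascFac_pos hc n
  have h₁ : 0 < ascFac (c + 1) n := ascFac_pos (Nat.le_add_left 1 c) n
  calc postWeight c K n D
      ≤ (1 / ascFac (c + 1) n) / (1 / ascFac c n) :=
        div_le_div₀ (one_div_pos.2 h₁).le
          (one_div_le_one_div_of_le h₁
            (ascFac_mono (Nat.add_le_add_left hD.card_pos c) n))
          (one_div_pos.2 h₀) (one_div_ascFac_le_Znorm hc K n)
    _ = c / (n + c : ℝ) := by
        have h := mul_ascFac_succ c n
        field_simp
        linarith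

theorem tendsto_postWeight_zero {c : ℕ} (hc : 1 ≤ c) (K : ℕ) {D : Finset (Fin (K - c))}
    (hD : D.Nonempty) : Tendsto (fun n => postWeight c K n D) atTop (nhds 0) :=
  squeeze_zero (fun n => postWeight_nonneg hc K n D) (fun n => postWeight_le hc K n hD)
    (tendsto_const_nhds.div_atTop
      (tendsto_atTop_add_const_right _ _ tendsto_natCast_atTop_atTop))

theorem tendsto_sum_postWeight_zero {c : ℕ} (hc : 1 ≤ c) (K : ℕ)
    {S : Finset (Finset (Fin (K - c)))} (hS : ∅ ∉ S) :
    Tendsto (fun n => ∑ D ∈ S, postWeight c K n D) atTop (nhds 0) := by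
  simpa using tendsto_finsetSum S fun D hD =>
    tendsto_postWeight_zero hc K (Finset.nonempty_iff_ne_empty.2 fun h => hS (h ▸ hD))

/-- Convergence of Hypotheses: for `1 ≤ c ≤ K` and any family `S` of
subsets of `{1,…,K-c}` (representing a hypothesis `h` equal to the disjunction of the
corresponding constituents), the posterior probability `∑_{D ∈ S} q_n(D)` of the
hypothesis tends to `1` as `n → ∞` if the minimal constituent `D = ∅` belongs to `S`,
and tends to `0` as `n → ∞` otherwise. -/
theorem hypothesis_posterior_convergence (c K : ℕ) (hc : 1 ≤ c) (hcK : c ≤ K)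
    (S : Finset (Finset (Fin (K - c)))) :
    ((∅ : Finset (Fin (K - c))) ∈ S →
      Tendsto (fun n : ℕ => ∑ D ∈ S, postWeight c K n D) atTop (nhds 1)) ∧
    ((∅ : Finset (Fin (K - c))) ∉ S →
      Tendsto (fun n : ℕ => ∑ D ∈ S, postWeight c K n D) atTop (nhds 0)) := by
  refine ⟨fun hS => ?_, tendsto_sum_postWeight_zero hc K⟩
  have h := (tendsto_sum_postWeight_zero hc K (S := Sᶜ) (by simpa using hS)).const_sub 1
  rw [sub_zero] at h
  refine h.congr fun n => ?_
  rw [← sum_postWeight hc K n, ← Finset.sum_add_sum_compl S, add_sub_cancel_right]
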